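/- Let r be an odd positive integer and let f : ℝ → ℝ be of class C^{r+1} with f^{(r+1)} continuous, nonnegative on ℝ, and {x : f^{(r+1)}(x) = 0} finite. Suppose in addition there exist T > 0 and m > 0 such that f^{(r+1)}(x) ≥ m whenever |x| > T. Then for every point P = (s, t) with t < f(s), exactly two distinct Taylor polynomials of order r of f pass through P; that is, the set of functions { P_c : c ∈ ℝ, P_c(s) = t } has exactly two elements, where P_c denotes the Taylor polynomial of order r of f centered at c. -/

import Mathlib

/-- The Taylor polynomial of order `r` of `f` centered at `c`, as a function on `ℝ`. -/
noncomputable def taylorPoly (f : ℝ → ℝ) (r : ℕ) (c : ℝ) : ℝ → ℝ :=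
  fun x => ∑ k ∈ Finset.range (r + 1), iteratedDeriv k f c / (k.factorial : ℝ) * (x - c) ^ k

open Set

/-- A function with nonnegative derivative to the left of `s`, vanishing there only finitely
often, is strictly increasing on `Iic s`. -/
theorem strictMonoOn_Iic_of_hasDerivAt_nonneg {h h' : ℝ → ℝ} {s : ℝ}
    (hderiv : ∀ x, HasDerivAt h (h' x) x) (hnonneg : ∀ x < s, 0 ≤ h' x)
    (hzero : {x | x < s ∧ h' x = 0}.Finite) : StrictMonoOn h (Iic s) := by
  have hmono : MonotoneOn h (Iic s) :=
    monotoneOn_of_deriv_nonneg (convex_Iic s)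
      (fun x _ => (hderiv x).continuousAt.continuousWithinAt)
      (fun x _ => (hderiv x).differentiableAt.differentiableWithinAt)
      (fun x hx => by
        rw [interior_Iic] at hx
        rw [(hderiv x).deriv]
        exact hnonneg x hx)
  intro a ha b hb hab
  refine (hmono ha hb hab.le).lt_of_ne fun heq => ?_
  refine (Ioo_infinite hab).mono (fun x hx => ?_) hzero
  have hxs : x < s := hx.2.trans_le hb
  refine ⟨hxs, ?_⟩
  have hconst : h =ᶠ[nhds x] fun _ => h a := by
    filter_upwards [isOpen_Ioo.mem_nhds hx] with y hy
    have hys : y ∈ Iic s := (hy.2.trans_le hb).le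
    exact le_antisymm ((hmono hys hb hy.2.le).trans heq.ge) (hmono ha hys hy.1.le)
  exact (hderiv x).unique ((hasDerivAt_const x (h a)).congr_of_eventuallyEq hconst)

/-- A function whose derivative is bounded below by a positive constant near `-∞` takes every
value less than `h s` to the left of `s`. -/
theorem exists_lt_eq_of_le_hasDerivAt {h h' : ℝ → ℝ} {s a k t : ℝ}
    (hderiv : ∀ x, HasDerivAt h (h' x) x) (hk : 0 < k) (hbound : ∀ x < a, k ≤ h' x)
    (hst : t < h s) : ∃ c < s, h c = t := by
  have hcont : Continuous h :=
    continuous_iff_continuousAt.2 fun x => (hderiv x).continuousAt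
  obtain ⟨b, hbs, hbt⟩ : ∃ b ≤ s, h b ≤ t := by
    set p := min a s
    set b := p - max 0 ((h p - t) / k) with hb
    have hbp : b ≤ p := by rw [hb]; linarith [le_max_left 0 ((h p - t) / k)]
    refine ⟨b, hbp.trans (min_le_right a s), ?_⟩
    have hgrow := (convex_Iic p).mul_sub_le_image_sub_of_le_deriv hcont.continuousOn
      (fun x _ => (hderiv x).differentiableAt.differentiableWithinAt) (C := k)
      (fun x hx => by
        rw [interior_Iic] at hx
        rw [(hderiv x).deriv]
        exact hbound x (hx.trans_le (min_le_left a s))) b hbp p self_mem_Iic hbp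
    have hdist : h p - t ≤ k * (p - b) := by
      rw [mul_comm, ← div_le_iff₀ hk, hb]
      linarith [le_max_right 0 ((h p - t) / k)]
    linarith
  obtain ⟨c, hc, hct⟩ := intermediate_value_Icc hbs hcont.continuousOn ⟨hbt, hst.le⟩
  exact ⟨c, hc.2.lt_of_ne (by rintro rfl; exact hst.ne' hct), hct⟩

/-- The derivative of the Taylor polynomial with respect to its center. -/
theorem hasDerivAt_taylorPoly_center {f : ℝ → ℝ} {r : ℕ} (hf : ContDiff ℝ (r + 1 : ℕ) f)
    (x c : ℝ) :
    HasDerivAt (fun y => taylorPoly f r y x)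
      ((r.factorial : ℝ)⁻¹ * (x - c) ^ r * iteratedDeriv (r + 1) f c) c := by
  have heq : (fun y => taylorPoly f r y x) = fun y => taylorWithinEval f r univ y x := by
    funext y
    simp only [taylorPoly, taylor_within_apply, iteratedDerivWithin_univ, smul_eq_mul]
    exact Finset.sum_congr rfl fun k _ => by ring
  have hdiff := hf.differentiable_iteratedDeriv r (by exact_mod_cast r.lt_succ_self)
  have hT := hasDerivWithinAt_taylorWithinEval (x := x) (y := c) (n := r) uniqueDiffOn_univ
    Filter.univ_mem (mem_univ c) subset_rfl
    (hf.of_le (by exact_mod_cast r.le_succ)).contDiffOn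
    (by rw [iteratedDerivWithin_univ]; exact (hdiff c).differentiableWithinAt)
  rw [heq]
  simpa [iteratedDerivWithin_univ] using hT

theorem taylorPoly_self (f : ℝ → ℝ) (r : ℕ) (c : ℝ) : taylorPoly f r c c = f c := by
  simp [taylorPoly, Finset.sum_range_succ']

/-- The derivative of the reflected map `y ↦ P_{-y}(x)`, for odd order. -/
theorem hasDerivAt_taylorPoly_neg_center {f : ℝ → ℝ} {r : ℕ} (hr : Odd r)
    (hf : ContDiff ℝ (r + 1 : ℕ) f) (x y : ℝ) :
    HasDerivAt (fun y => taylorPoly f r (-y) x)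
      ((r.factorial : ℝ)⁻¹ * (-x - y) ^ r * iteratedDeriv (r + 1) f (-y)) y := by
  have hcomp := (hasDerivAt_taylorPoly_center hf x (-y)).comp y (hasDerivAt_neg y)
  refine hcomp.congr_deriv ?_
  have hneg : x - -y = -(-x - y) := by ring
  rw [hneg, hr.neg_pow]
  ring

section

variable {f : ℝ → ℝ} {r : ℕ}

theorem strictMonoOn_taylorPoly_center (hf : ContDiff ℝ (r + 1 : ℕ) f)
    (hnonneg : ∀ x : ℝ, 0 ≤ iteratedDeriv (r + 1) f x)
    (hfin : {x : ℝ | iteratedDeriv (r + 1) f x = 0}.Finite) (x : ℝ) :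
    StrictMonoOn (fun c => taylorPoly f r c x) (Iic x) := by
  refine strictMonoOn_Iic_of_hasDerivAt_nonneg (hasDerivAt_taylorPoly_center hf x)
    (fun c hc => ?_) (hfin.subset fun c hc => ?_)
  · have := sub_pos.2 hc
    have := hnonneg c
    positivity
  · have hpos := sub_pos.2 hc.1
    exact (mul_eq_zero.1 hc.2).resolve_left (by positivity)

theorem strictAntiOn_taylorPoly_center (hr : Odd r) (hf : ContDiff ℝ (r + 1 : ℕ) f)
    (hnonneg : ∀ x : ℝ, 0 ≤ iteratedDeriv (r + 1) f x)
    (hfin : {x : ℝ | iteratedDeriv (r + 1) f x = 0}.Finite) (x : ℝ) :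
    StrictAntiOn (fun c => taylorPoly f r c x) (Ici x) := by
  have hmono : StrictMonoOn (fun y => taylorPoly f r (-y) x) (Iic (-x)) := by
    refine strictMonoOn_Iic_of_hasDerivAt_nonneg (hasDerivAt_taylorPoly_neg_center hr hf x)
      (fun y hy => ?_) ((hfin.preimage neg_injective.injOn).subset fun y hy => ?_)
    · have := sub_pos.2 hy
      have := hnonneg (-y)
      positivity
    · have hpos := sub_pos.2 hy.1
      exact (mul_eq_zero.1 hy.2).resolve_left (by positivity)
  intro a ha b hb hab
  simpa using hmono (mem_Iic.2 (neg_le_neg hb)) (mem_Iic.2 (neg_le_neg ha)) (neg_lt_neg hab)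

/-- Away from its center, the Taylor polynomial lies strictly below the graph. -/
theorem taylorPoly_lt_of_ne (hr : Odd r) (hf : ContDiff ℝ (r + 1 : ℕ) f)
    (hnonneg : ∀ x : ℝ, 0 ≤ iteratedDeriv (r + 1) f x)
    (hfin : {x : ℝ | iteratedDeriv (r + 1) f x = 0}.Finite) {c x : ℝ} (hcx : c ≠ x) :
    taylorPoly f r c x < f x := by
  rw [← taylorPoly_self f r x]
  rcases hcx.lt_or_gt with hlt | hlt
  · exact strictMonoOn_taylorPoly_center hf hnonneg hfin x hlt.le self_mem_Iic hlt
  · exact strictAntiOn_taylorPoly_center hr hf hnonneg hfin x self_mem_Ici hlt.le hlt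

/-- Distinct centers give distinct Taylor polynomials. -/
theorem taylorPoly_injective (hr : Odd r) (hf : ContDiff ℝ (r + 1 : ℕ) f)
    (hnonneg : ∀ x : ℝ, 0 ≤ iteratedDeriv (r + 1) f x)
    (hfin : {x : ℝ | iteratedDeriv (r + 1) f x = 0}.Finite) :
    Function.Injective (taylorPoly f r) := by
  intro c d hcd
  by_contra hne
  refine (taylorPoly_lt_of_ne hr hf hnonneg hfin hne).ne ?_
  rw [hcd, taylorPoly_self]

theorem exists_center_lt (hf : ContDiff ℝ (r + 1 : ℕ) f) {T m : ℝ} (hm : 0 < m)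
    (hbound : ∀ x : ℝ, T < |x| → m ≤ iteratedDeriv (r + 1) f x) {s t : ℝ} (hst : t < f s) :
    ∃ c < s, taylorPoly f r c s = t := by
  refine exists_lt_eq_of_le_hasDerivAt (h := fun c => taylorPoly f r c s) (a := min (-T) (s - 1))
    (k := (r.factorial : ℝ)⁻¹ * 1 * m) (hasDerivAt_taylorPoly_center hf s) (by positivity)
    (fun x hx => ?_) (by rwa [taylorPoly_self])
  rw [lt_min_iff] at hx
  have hpow : 1 ≤ (s - x) ^ r := one_le_pow₀ (by linarith)
  have := hbound x (lt_abs.2 (.inr (by linarith)))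
  gcongr

theorem exists_center_gt (hr : Odd r) (hf : ContDiff ℝ (r + 1 : ℕ) f) {T m : ℝ} (hm : 0 < m)
    (hbound : ∀ x : ℝ, T < |x| → m ≤ iteratedDeriv (r + 1) f x) {s t : ℝ} (hst : t < f s) :
    ∃ c > s, taylorPoly f r c s = t := by
  obtain ⟨y, hy, hyt⟩ := exists_lt_eq_of_le_hasDerivAt (h := fun y => taylorPoly f r (-y) s)
    (s := -s) (t := t) (a := min (-T) (-s - 1)) (k := (r.factorial : ℝ)⁻¹ * 1 * m)
    (hasDerivAt_taylorPoly_neg_center hr hf s) (by positivity)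
    (fun x hx => by
      rw [lt_min_iff] at hx
      have hpow : 1 ≤ (-s - x) ^ r := one_le_pow₀ (by linarith)
      have := hbound (-x) (lt_abs.2 (.inl (by linarith)))
      gcongr) (by rwa [neg_neg, taylorPoly_self])
  exact ⟨-y, lt_neg_of_lt_neg hy, hyt⟩

end

/-- **Theorem (Horwitz, Section 3).** Let `r` be an odd positive integer and `f ∈ C^{r+1}`
with `f^{(r+1)}` nonnegative on `ℝ` with finitely many zeros, and `f^{(r+1)} ≥ m > 0`
outside `[-T, T]`. Then every point `(s, t)` with `t < f(s)` is passed through by exactly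
two distinct Taylor polynomials of order `r` of `f`. -/
theorem exactly_two_taylor_polys_below_graph
    (r : ℕ) (hr : Odd r) (hrpos : 0 < r)
    (f : ℝ → ℝ) (hf : ContDiff ℝ (r + 1 : ℕ) f)
    (hnonneg : ∀ x : ℝ, 0 ≤ iteratedDeriv (r + 1) f x)
    (hfin : {x : ℝ | iteratedDeriv (r + 1) f x = 0}.Finite)
    (T m : ℝ) (hT : 0 < T) (hm : 0 < m)
    (hbound : ∀ x : ℝ, T < |x| → m ≤ iteratedDeriv (r + 1) f x)
    (s t : ℝ) (hst : t < f s) :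
    {g : ℝ → ℝ | ∃ c : ℝ, taylorPoly f r c s = t ∧ g = taylorPoly f r c}.ncard = 2 := by
  obtain ⟨c₁, hc₁, hc₁t⟩ := exists_center_lt hf hm hbound hst
  obtain ⟨c₂, hc₂, hc₂t⟩ := exists_center_gt hr hf hm hbound hst
  rw [Set.ncard_eq_two]
  refine ⟨taylorPoly f r c₁, taylorPoly f r c₂,
    (taylorPoly_injective hr hf hnonneg hfin).ne (hc₁.trans hc₂).ne, ?_⟩
  ext g
  constructor
  · rintro ⟨c, hct, rfl⟩
    rcases le_total c s with hcs | hcs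
    · left
      rw [(strictMonoOn_taylorPoly_center hf hnonneg hfin s).injOn hcs hc₁.le
        (hct.trans hc₁t.symm)]
    · right
      rw [(strictAntiOn_taylorPoly_center hr hf hnonneg hfin s).injOn hcs hc₂.le
        (hct.trans hc₂t.symm)]
      rfl
  · rintro (rfl | rfl)
    · exact ⟨c₁, hc₁t, rfl⟩
    · exact ⟨c₂, hc₂t, rfl⟩
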